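/- Let x be an element of a Garside group G. If x is periodically geodesic and x^m is left rigid (respectively right rigid) for some m ≥ 1, then x is left rigid (respectively right rigid). -/

import Mathlib

/-!
Axiomatization of Garside groups (positive cone, Garside element, lattice
structure, left/right normal forms), following the paper
"On the cycling operation in braid groups" by Gebhardt and González-Meneses.
-/

namespace Garside

variable {G : Type*} [Group G]

/-- `a ≼ b`: `a` is a left divisor (prefix) of `b` w.r.t. the positive cone `P`. -/
def LeftDvd (P : Submonoid G) (a b : G) : Prop := a⁻¹ * b ∈ P

/-- `a` is a right divisor (suffix) of `b` w.r.t. the positive cone `P`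
(i.e. `b ≽ a` in the notation of the paper). -/
def RightDvd (P : Submonoid G) (a b : G) : Prop := b * a⁻¹ ∈ P

/-- A simple element: a positive prefix of `Δ`. -/
def Simple (P : Submonoid G) (Δ : G) (s : G) : Prop := s ∈ P ∧ LeftDvd P s Δ

/-- An atom: a nontrivial positive element which is not the product
of two nontrivial positive elements. -/
def Atom (P : Submonoid G) (a : G) : Prop :=
  a ∈ P ∧ a ≠ 1 ∧ ∀ b c : G, b ∈ P → c ∈ P → a = b * c → b = 1 ∨ c = 1

/-- `Δ^p x₁ ⋯ x_r` (with `l = [x₁,…,x_r]`) is the left normal form of `x`: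
each factor is a proper simple element and consecutive factors are
left-weighted, `x_i = (x_i x_{i+1}) ∧_L Δ`. -/
def IsLeftNF (P : Submonoid G) (Δ : G) (gcdL : G → G → G) (p : ℤ) (l : List G) (x : G) :
    Prop :=
  x = Δ ^ p * l.prod ∧ (∀ s ∈ l, Simple P Δ s ∧ s ≠ 1 ∧ s ≠ Δ) ∧
    l.Chain' (fun s t => gcdL (s * t) Δ = s)

/-- `y₁ ⋯ y_r Δ^p` (with `l = [y₁,…,y_r]`) is the right normal form of `x`:
each factor is a proper simple element and consecutive factors are
right-weighted, `y_{i+1} = (y_i y_{i+1}) ∧_R Δ`. -/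
def IsRightNF (P : Submonoid G) (Δ : G) (gcdR : G → G → G) (p : ℤ) (l : List G) (x : G) :
    Prop :=
  x = l.prod * Δ ^ p ∧ (∀ s ∈ l, Simple P Δ s ∧ s ≠ 1 ∧ s ≠ Δ) ∧
    l.Chain' (fun s t => gcdR (s * t) Δ = t)

/-- A Garside structure on a group `G`: a positive cone which induces lattice
orders by left and right divisibility, and a Garside element `Δ` whose left and
right divisors coincide (the simple elements), generate the group, and such that
every element admits a unique left and right normal form. -/
structure GarsideGroup (G : Type*) [Group G] where
  pos : Submonoid G
  pos_antisymm : ∀ a : G, a ∈ pos → a⁻¹ ∈ pos → a = 1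
  Δ : G
  Δ_pos : Δ ∈ pos
  gcdL : G → G → G
  gcdL_dvd_left : ∀ a b : G, LeftDvd pos (gcdL a b) a
  gcdL_dvd_right : ∀ a b : G, LeftDvd pos (gcdL a b) b
  dvd_gcdL : ∀ a b c : G, LeftDvd pos c a → LeftDvd pos c b → LeftDvd pos c (gcdL a b)
  lcmL : G → G → G
  dvd_lcmL_left : ∀ a b : G, LeftDvd pos a (lcmL a b)
  dvd_lcmL_right : ∀ a b : G, LeftDvd pos b (lcmL a b)
  lcmL_dvd : ∀ a b c : G, LeftDvd pos a c → LeftDvd pos b c → LeftDvd pos (lcmL a b) c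
  gcdR : G → G → G
  gcdR_dvd_left : ∀ a b : G, RightDvd pos (gcdR a b) a
  gcdR_dvd_right : ∀ a b : G, RightDvd pos (gcdR a b) b
  dvd_gcdR : ∀ a b c : G, RightDvd pos c a → RightDvd pos c b → RightDvd pos c (gcdR a b)
  lcmR : G → G → G
  dvd_lcmR_left : ∀ a b : G, RightDvd pos a (lcmR a b)
  dvd_lcmR_right : ∀ a b : G, RightDvd pos b (lcmR a b)
  lcmR_dvd : ∀ a b c : G, RightDvd pos a c → RightDvd pos b c → RightDvd pos (lcmR a b) c
  divisors_Δ : ∀ s : G, (s ∈ pos ∧ LeftDvd pos s Δ) ↔ (s ∈ pos ∧ RightDvd pos s Δ)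
  simples_generate : Subgroup.closure {s : G | Simple pos Δ s} = ⊤
  lnf_exists : ∀ x : G, ∃ pl : ℤ × List G, IsLeftNF pos Δ gcdL pl.1 pl.2 x
  lnf_unique : ∀ (x : G) (p q : ℤ) (l m : List G),
    IsLeftNF pos Δ gcdL p l x → IsLeftNF pos Δ gcdL q m x → p = q ∧ l = m
  rnf_exists : ∀ x : G, ∃ pl : ℤ × List G, IsRightNF pos Δ gcdR pl.1 pl.2 x
  rnf_unique : ∀ (x : G) (p q : ℤ) (l m : List G),
    IsRightNF pos Δ gcdR p l x → IsRightNF pos Δ gcdR q m x → p = q ∧ l = m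
  lnf_rnf_agree : ∀ (x : G) (p q : ℤ) (l m : List G),
    IsLeftNF pos Δ gcdL p l x → IsRightNF pos Δ gcdR q m x → p = q ∧ l.length = m.length

/-- `L` is the left lcm of the set `S`. -/
def IsLcmL (P : Submonoid G) (S : Set G) (L : G) : Prop :=
  (∀ a ∈ S, LeftDvd P a L) ∧ ∀ c : G, (∀ a ∈ S, LeftDvd P a c) → LeftDvd P L c

/-- A Garside group is atom-friendly (on the left) if `Δ` is the left lcm of the
set of atoms and the starting set of the left lcm of any set `B` of atoms is `B`. -/
def AtomFriendlyL (𝒢 : GarsideGroup G) : Prop :=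
  IsLcmL 𝒢.pos {a : G | Atom 𝒢.pos a} 𝒢.Δ ∧
    ∀ B : Set G, B ⊆ {a : G | Atom 𝒢.pos a} →
      ∃ L : G, IsLcmL 𝒢.pos B L ∧ {a : G | Atom 𝒢.pos a ∧ LeftDvd 𝒢.pos a L} = B

namespace GarsideGroup

variable (𝒢 : GarsideGroup G)

/-- The left normal form of `x`, as a pair (infimum, list of factors). -/
noncomputable def lnf (x : G) : ℤ × List G := Classical.choose (𝒢.lnf_exists x)

/-- The right normal form of `x`, as a pair (exponent of `Δ`, list of factors). -/
noncomputable def rnf (x : G) : ℤ × List G := Classical.choose (𝒢.rnf_exists x)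

/-- `inf x = p`, the maximal `p` with `Δ^p ≼ x`. -/
noncomputable def inf (x : G) : ℤ := (𝒢.lnf x).1

/-- The canonical length `ℓ(x) = r`. -/
noncomputable def len (x : G) : ℕ := (𝒢.lnf x).2.length

/-- `sup x = p + r`. -/
noncomputable def sup (x : G) : ℤ := 𝒢.inf x + 𝒢.len x

/-- `tau 𝒢 k x = τ^k(x) = Δ^{-k} x Δ^k`. -/
def tau (k : ℤ) (x : G) : G := 𝒢.Δ ^ (-k) * x * 𝒢.Δ ^ k

/-- The left initial factor `ι_L(x) = τ^{-p}(x₁)` (equal to `1` if `ℓ(x) = 0`). -/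
noncomputable def iotaL (x : G) : G := 𝒢.tau (-(𝒢.lnf x).1) ((𝒢.lnf x).2.headD 1)

/-- The right initial factor `ι_R(x) = τ^{p}(y_r)` (equal to `1` if `ℓ(x) = 0`). -/
noncomputable def iotaR (x : G) : G := 𝒢.tau (𝒢.rnf x).1 (((𝒢.rnf x).2.getLast?).getD 1)

/-- Left cycling: `c_L(x) = ι_L(x)⁻¹ · x · ι_L(x)`. -/
noncomputable def cL (x : G) : G := (𝒢.iotaL x)⁻¹ * x * 𝒢.iotaL x

/-- Right cycling: `c_R(x) = ι_R(x) · x · ι_R(x)⁻¹`. -/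
noncomputable def cR (x : G) : G := 𝒢.iotaR x * x * (𝒢.iotaR x)⁻¹

/-- `x = Δ^p x₁⋯x_r` (in left normal form, `r > 0`) is left rigid if
`Δ^p x₁⋯x_r ι_L(x)` is in left normal form as written. -/
def LeftRigid (x : G) : Prop :=
  (𝒢.lnf x).2 ≠ [] ∧
    IsLeftNF 𝒢.pos 𝒢.Δ 𝒢.gcdL (𝒢.lnf x).1 ((𝒢.lnf x).2 ++ [𝒢.iotaL x]) (x * 𝒢.iotaL x)

/-- `x = y₁⋯y_r Δ^p` (in right normal form, `r > 0`) is right rigid if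
`ι_R(x) y₁⋯y_r Δ^p` is in right normal form as written. -/
def RightRigid (x : G) : Prop :=
  (𝒢.rnf x).2 ≠ [] ∧
    IsRightNF 𝒢.pos 𝒢.Δ 𝒢.gcdR (𝒢.rnf x).1 (𝒢.iotaR x :: (𝒢.rnf x).2) (𝒢.iotaR x * x)

/-- The super summit set: conjugates of minimal canonical length. -/
def SSS (x : G) : Set G :=
  {y | IsConj x y ∧ ∀ z : G, IsConj x z → 𝒢.len y ≤ 𝒢.len z}

/-- The left ultra summit set. -/
def USSL (x : G) : Set G :=
  {y ∈ 𝒢.SSS x | ∃ t : ℕ, 1 ≤ t ∧ (𝒢.cL)^[t] y = y}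

/-- The right ultra summit set. -/
def USSR (x : G) : Set G :=
  {y ∈ 𝒢.SSS x | ∃ t : ℕ, 1 ≤ t ∧ (𝒢.cR)^[t] y = y}

/-- `x` is periodically geodesic: `inf(x^m) = m inf(x)` and `sup(x^m) = m sup(x)`
for all `m ≥ 1`. -/
def PeriodicallyGeodesic (x : G) : Prop :=
  ∀ m : ℕ, 1 ≤ m → 𝒢.inf (x ^ m) = (m : ℤ) * 𝒢.inf x ∧ 𝒢.sup (x ^ m) = (m : ℤ) * 𝒢.sup x

/-- The left interior `x°_L = x Δ^{-p}`, where `p = inf(x)`. -/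
noncomputable def intL (x : G) : G := x * 𝒢.Δ ^ (-𝒢.inf x)

/-- The right interior `x°_R = Δ^{-p} x`, where `p = inf(x)`. -/
noncomputable def intR (x : G) : G := 𝒢.Δ ^ (-𝒢.inf x) * x

/-- The right transport of `v` (where `v x v⁻¹ = z`):
`v^{(1)}_R = ι_R(z) · v · ι_R(x)⁻¹`. -/
noncomputable def transR (x v : G) : G := 𝒢.iotaR (v * x * v⁻¹) * v * (𝒢.iotaR x)⁻¹

/-- The iterated right transport `v^{(i)}_R` of `v` along the right cyclings of `x`. -/
noncomputable def transRIter (x : G) : ℕ → G → G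
  | 0, v => v
  | i + 1, v => 𝒢.transR ((𝒢.cR)^[i] x) (transRIter x i v)

/-- Arrows of the left ultra summit graph `USG_L(x)`: triples `(u, s, v)` with
`u, v ∈ USS_L(x)`, `s` simple and `s⁻¹ u s = v`. -/
def ArrL (x : G) : Set (G × G × G) :=
  {a | a.1 ∈ 𝒢.USSL x ∧ a.2.2 ∈ 𝒢.USSL x ∧ Simple 𝒢.pos 𝒢.Δ a.2.1 ∧
    a.2.1⁻¹ * a.1 * a.2.1 = a.2.2}

/-- Arrows of the right ultra summit graph `USG_R(x)`: triples `(u, s, v)` with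
`u, v ∈ USS_R(x)`, `s` simple and `s u s⁻¹ = v`. -/
def ArrR (x : G) : Set (G × G × G) :=
  {a | a.1 ∈ 𝒢.USSR x ∧ a.2.2 ∈ 𝒢.USSR x ∧ Simple 𝒢.pos 𝒢.Δ a.2.1 ∧
    a.2.1 * a.1 * a.2.1⁻¹ = a.2.2}

/-- `PathFrom A u l`: the list of arrows `l` forms a directed path in the
graph with arrow set `A`, starting at the vertex `u`. -/
def PathFrom (A : Set (G × G × G)) : G → List (G × G × G) → Prop
  | _, [] => True
  | u, a :: rest => a ∈ A ∧ a.1 = u ∧ PathFrom A a.2.2 rest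

/-- Minimal arrows of `USG_L(x)`: arrows whose label is not a product of the
labels of a directed path of length at least 2 starting at the same vertex. -/
def MinArrL (x : G) : Set (G × G × G) :=
  {a | a ∈ 𝒢.ArrL x ∧ ¬ ∃ l : List (G × G × G), 2 ≤ l.length ∧
    PathFrom (𝒢.ArrL x) a.1 l ∧ (l.map (fun b => b.2.1)).prod = a.2.1}

/-- Minimal arrows of `USG_R(x)`. -/
def MinArrR (x : G) : Set (G × G × G) :=
  {a | a ∈ 𝒢.ArrR x ∧ ¬ ∃ l : List (G × G × G), 2 ≤ l.length ∧
    PathFrom (𝒢.ArrR x) a.1 l ∧ (l.map (fun b => b.2.1)).prod = a.2.1}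

end GarsideGroup

end Garside

namespace Garside


namespace GarsideGroup

section aux
variable {G : Type*} [Group G] (𝒢 : GarsideGroup G)

theorem ld_trans {P : Submonoid G} {a b c : G} (h : LeftDvd P a b) (h' : LeftDvd P b c) :
    LeftDvd P a c := by
  have := P.mul_mem h h'
  unfold LeftDvd
  convert this using 1
  group

theorem ld_refl {P : Submonoid G} (a : G) : LeftDvd P a a := by
  simp [LeftDvd]

theorem ld_mul_left {P : Submonoid G} {a b : G} (c : G) :
    LeftDvd P (c * a) (c * b) ↔ LeftDvd P a b := by
  unfold LeftDvd
  rw [show (c * a)⁻¹ * (c * b) = a⁻¹ * b by group]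

theorem ld_mul {P : Submonoid G} {a b : G} (hb : b ∈ P) : LeftDvd P a (a * b) := by
  simpa [LeftDvd] using hb

theorem ld_antisymm {a b : G} (h : LeftDvd 𝒢.pos a b) (h' : LeftDvd 𝒢.pos b a) : a = b := by
  have := 𝒢.pos_antisymm _ h (by simpa [LeftDvd] using h')
  exact (inv_mul_eq_one.mp this)

theorem gcd_eq {a b d : G} (h1 : LeftDvd 𝒢.pos d a) (h2 : LeftDvd 𝒢.pos d b)
    (h3 : LeftDvd 𝒢.pos (𝒢.gcdL a b) d) : 𝒢.gcdL a b = d :=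
  𝒢.ld_antisymm h3 (𝒢.dvd_gcdL _ _ _ h1 h2)

theorem Δ_ne_one : 𝒢.Δ ≠ 1 := by
  intro h
  have := 𝒢.lnf_unique 1 0 1 [] [] ⟨by simp, by simp, List.IsChain.nil⟩ ⟨by simp [h], by simp, List.IsChain.nil⟩
  simp at this

theorem simple_tau {s : G} (h : Simple 𝒢.pos 𝒢.Δ s) : 𝒢.Δ⁻¹ * s * 𝒢.Δ ∈ 𝒢.pos := by
  have h1 : s⁻¹ * 𝒢.Δ ∈ 𝒢.pos := h.2
  have h2 := (𝒢.divisors_Δ (s⁻¹ * 𝒢.Δ)).2 ⟨h1, by simpa [RightDvd] using h.1⟩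
  have := h2.2
  unfold LeftDvd at this
  convert this using 1
  group

theorem simple_tau' {s : G} (h : Simple 𝒢.pos 𝒢.Δ s) : 𝒢.Δ * s * 𝒢.Δ⁻¹ ∈ 𝒢.pos := by
  have h1 : 𝒢.Δ * s⁻¹ ∈ 𝒢.pos := ((𝒢.divisors_Δ s).1 h).2
  have h2 := (𝒢.divisors_Δ (𝒢.Δ * s⁻¹)).1 ⟨h1, by simpa [LeftDvd] using h.1⟩
  have := h2.2
  unfold RightDvd at this
  convert this using 1
  group

/-- The head of a left-weighted list is the gcd of its product with Δ. -/
theorem head_eq_gcd (h : G) (t : List G) (hs : ∀ s ∈ h :: t, Simple 𝒢.pos 𝒢.Δ s)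
    (hc : (h :: t).IsChain (fun s t => 𝒢.gcdL (s * t) 𝒢.Δ = s)) :
    𝒢.gcdL (h :: t).prod 𝒢.Δ = h := by
  induction t generalizing h with
  | nil =>
    have := hs h (by simp)
    exact 𝒢.gcd_eq (by simpa using ld_refl h) this.2 (by simpa using 𝒢.gcdL_dvd_left h 𝒢.Δ)
  | cons g t ih =>
    rw [List.isChain_cons_cons] at hc
    have hg := ih g (fun s hs' => hs s (by simp only [List.mem_cons] at hs' ⊢; tauto)) hc.2
    have hh := hs h (by simp)
    have htp : (g :: t).prod ∈ 𝒢.pos :=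
      Submonoid.list_prod_mem _ (fun s hs' => (hs s (List.mem_cons_of_mem _ hs')).1)
    rw [List.prod_cons]
    refine 𝒢.gcd_eq (ld_mul htp) hh.2 ?_
    set w := (g :: t).prod with hw
    set d := 𝒢.gcdL (h * w) 𝒢.Δ with hd
    have d1 : LeftDvd 𝒢.pos d (h * w) := 𝒢.gcdL_dvd_left _ _
    have d2 : LeftDvd 𝒢.pos d 𝒢.Δ := 𝒢.gcdL_dvd_right _ _
    have d3 : LeftDvd 𝒢.pos 𝒢.Δ (h * 𝒢.Δ) := by
      simpa [LeftDvd, mul_assoc] using 𝒢.simple_tau hh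
    have d4 : LeftDvd 𝒢.pos (h⁻¹ * d) (𝒢.gcdL w 𝒢.Δ) := by
      refine 𝒢.dvd_gcdL _ _ _ ?_ ?_
      · rw [← ld_mul_left h]; simpa using d1
      · rw [← ld_mul_left h]; simpa using ld_trans d2 d3
    rw [hg, ← ld_mul_left h] at d4
    have := 𝒢.dvd_gcdL _ _ _ (by simpa using d4) d2
    rwa [hc.1] at this

theorem lnf_spec (x : G) : IsLeftNF 𝒢.pos 𝒢.Δ 𝒢.gcdL (𝒢.lnf x).1 (𝒢.lnf x).2 x :=
  Classical.choose_spec (𝒢.lnf_exists x)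

theorem rnf_spec (x : G) : IsRightNF 𝒢.pos 𝒢.Δ 𝒢.gcdR (𝒢.rnf x).1 (𝒢.rnf x).2 x :=
  Classical.choose_spec (𝒢.rnf_exists x)

theorem pos_eq_prod {a : G} (ha : a ∈ 𝒢.pos) : ∃ (n : ℕ) (l : List G),
    (∀ s ∈ l, Simple 𝒢.pos 𝒢.Δ s) ∧ a = 𝒢.Δ ^ n * l.prod := by
  obtain ⟨h1, h2, h3⟩ := 𝒢.lnf_spec a
  set p := (𝒢.lnf a).1
  set l := (𝒢.lnf a).2
  by_cases hp : 0 ≤ p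
  · obtain ⟨n, hn⟩ := Int.eq_ofNat_of_zero_le hp
    refine ⟨n, l, fun s hs => (h2 s hs).1, ?_⟩
    rw [h1, hn]; simp
  · exfalso
    obtain ⟨n, hn⟩ : ∃ n : ℕ, p = -(n + 1 : ℤ) := ⟨(-p - 1).toNat, by omega⟩
    have hd : LeftDvd 𝒢.pos 𝒢.Δ l.prod := by
      have : 𝒢.Δ ^ n * a ∈ 𝒢.pos := 𝒢.pos.mul_mem (𝒢.pos.pow_mem 𝒢.Δ_pos n) ha
      unfold LeftDvd
      convert this using 1
      rw [h1, hn]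
      group
    cases hl : l with
    | nil =>
      rw [hl] at hd
      exact 𝒢.Δ_ne_one (𝒢.pos_antisymm _ 𝒢.Δ_pos (by simpa [LeftDvd] using hd))
    | cons h t =>
      rw [hl] at hd h2 h3
      have := 𝒢.head_eq_gcd h t (fun s hs => (h2 s hs).1) h3
      have h4 : 𝒢.gcdL (h :: t).prod 𝒢.Δ = 𝒢.Δ :=
        𝒢.gcd_eq hd (ld_refl _) (𝒢.gcdL_dvd_right _ _)
      exact (h2 h (by simp)).2.2 (by rw [← this, h4])

theorem conj_pos_aux (g : G) (hg : g * 𝒢.Δ = 𝒢.Δ * g)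
    (hs : ∀ s, Simple 𝒢.pos 𝒢.Δ s → g * s * g⁻¹ ∈ 𝒢.pos)
    {a : G} (ha : a ∈ 𝒢.pos) : g * a * g⁻¹ ∈ 𝒢.pos := by
  obtain ⟨n, l, hl, rfl⟩ := 𝒢.pos_eq_prod ha
  have hc : Commute g (𝒢.Δ ^ n) := (show Commute g 𝒢.Δ from hg).pow_right n
  have : g * (𝒢.Δ ^ n * l.prod) * g⁻¹ = 𝒢.Δ ^ n * (g * l.prod * g⁻¹) := by
    rw [← mul_assoc, hc.eq]; group
  rw [this]
  refine 𝒢.pos.mul_mem (𝒢.pos.pow_mem 𝒢.Δ_pos n) ?_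
  clear ha this
  induction l with
  | nil => simp
  | cons h t ih =>
    have h1 := hs h (hl h (by simp))
    have h2 := ih (fun s h => hl s (List.mem_cons_of_mem _ h))
    convert 𝒢.pos.mul_mem h1 h2 using 1
    rw [List.prod_cons]; group

theorem conj_pos {a : G} (k : ℤ) (ha : a ∈ 𝒢.pos) :
    𝒢.Δ ^ k * a * 𝒢.Δ ^ (-k) ∈ 𝒢.pos := by
  have key : ∀ n : ℕ, 𝒢.Δ ^ (n : ℤ) * a * 𝒢.Δ ^ (-n : ℤ) ∈ 𝒢.pos ∧
      𝒢.Δ ^ (-n : ℤ) * a * 𝒢.Δ ^ (n : ℤ) ∈ 𝒢.pos := by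
    intro n
    induction n with
    | zero => simpa using ha
    | succ n ih =>
      constructor
      · have := 𝒢.conj_pos_aux 𝒢.Δ rfl (fun s h => 𝒢.simple_tau' h) ih.1
        convert this using 1
        push_cast
        group
      · have := 𝒢.conj_pos_aux 𝒢.Δ⁻¹ (by group)
          (fun s h => by simpa using 𝒢.simple_tau h) ih.2
        convert this using 1
        push_cast
        group
  obtain ⟨n, rfl | rfl⟩ := Int.eq_nat_or_neg k
  · exact (key n).1
  · simpa using (key n).2

theorem conj_pos_iff {a : G} (k : ℤ) :
    𝒢.Δ ^ k * a * 𝒢.Δ ^ (-k) ∈ 𝒢.pos ↔ a ∈ 𝒢.pos := by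
  refine ⟨fun h => ?_, 𝒢.conj_pos k⟩
  have := 𝒢.conj_pos (-k) h
  convert this using 1
  group

theorem ld_conj {a b : G} (k : ℤ) :
    LeftDvd 𝒢.pos (𝒢.Δ ^ k * a * 𝒢.Δ ^ (-k)) (𝒢.Δ ^ k * b * 𝒢.Δ ^ (-k)) ↔
      LeftDvd 𝒢.pos a b := by
  unfold LeftDvd
  rw [← 𝒢.conj_pos_iff k (a := a⁻¹ * b)]
  apply iff_of_eq
  congr 1
  group

theorem ld_mulΔ {a b : G} (k : ℤ) :
    LeftDvd 𝒢.pos (a * 𝒢.Δ ^ k) (b * 𝒢.Δ ^ k) ↔ LeftDvd 𝒢.pos a b := by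
  rw [← 𝒢.ld_conj k (a := a), ← ld_mul_left (𝒢.Δ ^ (-k)),
    ← 𝒢.ld_conj k (a := 𝒢.Δ ^ (-k) * (a * 𝒢.Δ ^ k))]
  have e : ∀ c : G, 𝒢.Δ ^ k * (𝒢.Δ ^ (-k) * (c * 𝒢.Δ ^ k)) * 𝒢.Δ ^ (-k) = c := by
    intro c; group
  rw [e, e, 𝒢.ld_conj k]

theorem ldΔ_mul {u v : G} {a b : ℤ} (hu : LeftDvd 𝒢.pos u (𝒢.Δ ^ a))
    (hv : LeftDvd 𝒢.pos v (𝒢.Δ ^ b)) : LeftDvd 𝒢.pos (u * v) (𝒢.Δ ^ (a + b)) := by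
  refine ld_trans ((ld_mul_left u).2 hv) ?_
  rw [zpow_add]
  exact (𝒢.ld_mulΔ b).2 hu

theorem ldΔ_pow {u : G} {a : ℤ} (hu : LeftDvd 𝒢.pos u (𝒢.Δ ^ a)) (k : ℕ) :
    LeftDvd 𝒢.pos (u ^ k) (𝒢.Δ ^ (k * a)) := by
  induction k with
  | zero => simpa using ld_refl _
  | succ k ih =>
    rw [pow_succ]
    have := 𝒢.ldΔ_mul ih hu
    convert this using 2
    push_cast; ring

theorem ldΔ_list (l : List G) (hl : ∀ s ∈ l, LeftDvd 𝒢.pos s 𝒢.Δ) :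
    LeftDvd 𝒢.pos l.prod (𝒢.Δ ^ (l.length : ℤ)) := by
  induction l with
  | nil => simpa using ld_refl _
  | cons h t ih =>
    have h1 : LeftDvd 𝒢.pos h (𝒢.Δ ^ (1 : ℤ)) := by simpa using hl h (by simp)
    have := 𝒢.ldΔ_mul h1 (ih (fun s h => hl s (List.mem_cons_of_mem _ h)))
    rw [List.prod_cons]
    convert this using 2
    push_cast [List.length_cons]; ring

theorem length_le (l : List G) (k : ℕ) (hs : ∀ s ∈ l, Simple 𝒢.pos 𝒢.Δ s ∧ s ≠ 1)
    (hc : l.IsChain (fun s t => 𝒢.gcdL (s * t) 𝒢.Δ = s))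
    (hd : LeftDvd 𝒢.pos l.prod (𝒢.Δ ^ (k : ℤ))) : l.length ≤ k := by
  induction k generalizing l with
  | zero =>
    cases l with
    | nil => simp
    | cons h t =>
      exfalso
      have ht : t.prod ∈ 𝒢.pos :=
        Submonoid.list_prod_mem _ (fun s h => (hs s (List.mem_cons_of_mem _ h)).1.1)
      have h1 := hs h (by simp)
      apply h1.2
      refine 𝒢.pos_antisymm _ h1.1.1 ?_
      have := 𝒢.pos.mul_mem ht hd
      convert this using 1
      rw [List.prod_cons]; simp
  | succ k ih =>
    cases l with
    | nil => simp
    | cons h t =>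
      have hg := 𝒢.head_eq_gcd h t (fun s h => (hs s h).1) hc
      set w := (h :: t).prod with hw
      have key : LeftDvd 𝒢.pos (w * 𝒢.Δ ^ (-(k : ℤ))) (𝒢.gcdL w 𝒢.Δ) := by
        refine 𝒢.dvd_gcdL _ _ _ ?_ ?_
        · rw [← 𝒢.ld_mulΔ k]
          have : w * 𝒢.Δ ^ (-(k : ℤ)) * 𝒢.Δ ^ (k : ℤ) = w := by group
          rw [this]
          exact ld_mul (by simpa using 𝒢.pos.pow_mem 𝒢.Δ_pos k)
        · rw [← 𝒢.ld_mulΔ k]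
          convert hd using 1
          · group
          · push_cast; group
      rw [hg, ← 𝒢.ld_mulΔ k] at key
      have key2 : LeftDvd 𝒢.pos t.prod (𝒢.Δ ^ (k : ℤ)) := by
        rw [← ld_mul_left h]
        convert key using 1
        rw [hw, List.prod_cons]; group
      have := ih t (fun s h => hs s (List.mem_cons_of_mem _ h)) hc.of_cons key2
      simpa using this

theorem posPow {x : G} {p : ℤ} (h : x * 𝒢.Δ ^ (-p) ∈ 𝒢.pos) (k : ℕ) :
    x ^ k * 𝒢.Δ ^ (-(k * p)) ∈ 𝒢.pos := by
  induction k with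
  | zero => simp
  | succ k ih =>
    have := 𝒢.pos.mul_mem h (𝒢.conj_pos p ih)
    convert this using 1
    rw [pow_succ']
    push_cast
    rw [show -(((k : ℤ) + 1) * p) = -(k * p) + -p by ring, zpow_add]
    group

theorem left_main (x : G) (hpg : 𝒢.PeriodicallyGeodesic x)
    (m : ℕ) (hm : 1 ≤ m) (hr : 𝒢.LeftRigid (x ^ m)) : 𝒢.LeftRigid x := by
  obtain ⟨hI, hS⟩ := hpg m hm
  obtain ⟨hr0, hr1⟩ := hr
  obtain ⟨x1, x2, x3⟩ := 𝒢.lnf_spec x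
  have X1 := (𝒢.lnf_spec (x ^ m)).1
  unfold sup len at hS
  rw [hI] at hS
  unfold inf at hI hS
  unfold LeftRigid
  unfold iotaL tau at hr1 ⊢
  rw [hI] at hr1 X1
  generalize (𝒢.lnf (x ^ m)).2 = L at *
  generalize (𝒢.lnf x).1 = p at *
  generalize (𝒢.lnf x).2 = l at *
  have hN : (L.length : ℤ) = m * l.length := by linarith
  cases l with
  | nil =>
    exfalso; simp at hN; exact hr0 hN
  | cons h t =>
  cases L with
  | nil => exact absurd rfl hr0
  | cons H T =>
  refine ⟨by simp, ?_⟩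
  simp only [List.headD_cons, neg_neg] at hr1 ⊢
  obtain ⟨-, R2, R3⟩ := hr1
  set ι := 𝒢.Δ ^ p * h * 𝒢.Δ ^ (-p) with hι
  set q : ℤ := m * p with hq
  set J := 𝒢.Δ ^ q * H * 𝒢.Δ ^ (-q) with hJ
  have hh := x2 h (by simp)
  have htp : t.prod ∈ 𝒢.pos :=
    Submonoid.list_prod_mem _ (fun s hs => (x2 s (List.mem_cons_of_mem _ hs)).1.1)
  have conjΔ : ∀ k : ℤ, 𝒢.Δ ^ k * 𝒢.Δ * 𝒢.Δ ^ (-k) = 𝒢.Δ := by intro k; group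
  have ιpos : ι ∈ 𝒢.pos := 𝒢.conj_pos p hh.1.1
  have ιΔ : LeftDvd 𝒢.pos ι 𝒢.Δ := by
    have := (𝒢.ld_conj p).2 hh.1.2
    rwa [conjΔ] at this
  have ιprop : Simple 𝒢.pos 𝒢.Δ ι ∧ ι ≠ 1 ∧ ι ≠ 𝒢.Δ := by
    refine ⟨⟨ιpos, ιΔ⟩, fun e => hh.2.1 ?_, fun e => hh.2.2 ?_⟩
    · have : h = 𝒢.Δ ^ (-p) * ι * 𝒢.Δ ^ p := by rw [hι]; group
      rw [this, e]; group
    · have : h = 𝒢.Δ ^ (-p) * ι * 𝒢.Δ ^ p := by rw [hι]; group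
      rw [this, e]; group
  -- step 1
  have hxp : x * 𝒢.Δ ^ (-p) = ι * (𝒢.Δ ^ p * t.prod * 𝒢.Δ ^ (-p)) := by
    rw [x1, hι, List.prod_cons]; group
  have hxpos : x * 𝒢.Δ ^ (-p) ∈ 𝒢.pos := by
    rw [hxp]; exact 𝒢.pos.mul_mem ιpos (𝒢.conj_pos p htp)
  have hιX : LeftDvd 𝒢.pos ι (x ^ m * 𝒢.Δ ^ (-q)) := by
    obtain ⟨k, rfl⟩ : ∃ k, m = k + 1 := ⟨m - 1, by omega⟩
    have e : x ^ (k + 1) * 𝒢.Δ ^ (-q) = ι * ((𝒢.Δ ^ p * t.prod * 𝒢.Δ ^ (-p)) *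
        (𝒢.Δ ^ p * (x ^ k * 𝒢.Δ ^ (-(k * p))) * 𝒢.Δ ^ (-p))) := by
      rw [← mul_assoc ι, ← hxp, pow_succ', hq]
      push_cast
      rw [show -(((k : ℤ) + 1) * p) = -(k * p) + -p by ring, zpow_add]
      group
    rw [e]
    exact ld_mul (𝒢.pos.mul_mem (𝒢.conj_pos p htp) (𝒢.conj_pos p (𝒢.posPow hxpos k)))
  have hHg : 𝒢.gcdL (H :: T).prod 𝒢.Δ = H :=
    𝒢.head_eq_gcd H T (fun s hs => (R2 s (List.mem_append_left _ hs)).1) R3.left_of_append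
  have hιJ : LeftDvd 𝒢.pos ι J := by
    have : LeftDvd 𝒢.pos (𝒢.Δ ^ (-q) * ι * 𝒢.Δ ^ (- -q)) (𝒢.gcdL (H :: T).prod 𝒢.Δ) := by
      refine 𝒢.dvd_gcdL _ _ _ ?_ ?_
      · rw [← 𝒢.ld_conj (-q), X1] at hιX
        convert hιX using 1
        group
      · rw [← 𝒢.ld_conj (-q), conjΔ] at ιΔ
        exact ιΔ
    rw [hHg, ← 𝒢.ld_conj q] at this
    convert this using 1
    group
  -- last elements
  obtain ⟨l', z, hz⟩ : ∃ l' z, h :: t = l' ++ [z] :=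
    ⟨_, _, (List.dropLast_append_getLast (List.cons_ne_nil h t)).symm⟩
  rw [hz] at x1 x2 x3 hN ⊢
  generalize hL : H :: T = L at *
  have zs := x2 z (by simp)
  set c := z⁻¹ * 𝒢.gcdL (z * ι) 𝒢.Δ with hc
  have hzc : z * c = 𝒢.gcdL (z * ι) 𝒢.Δ := by rw [hc]; group
  have cpos : c ∈ 𝒢.pos := 𝒢.dvd_gcdL _ _ _ (ld_mul ιpos) zs.1.2
  have cι : LeftDvd 𝒢.pos c ι := by
    rw [← ld_mul_left z, hzc]; exact 𝒢.gcdL_dvd_left _ _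
  -- step 2
  set r := (l' ++ [z]).length with hrr
  have hxD : LeftDvd 𝒢.pos x (𝒢.Δ ^ (p + r)) := by
    rw [x1]
    exact 𝒢.ldΔ_mul (ld_refl _) (𝒢.ldΔ_list _ (fun s hs => (x2 s hs).1.2))
  have hxcD : LeftDvd 𝒢.pos (x * c) (𝒢.Δ ^ (p + r)) := by
    have e : x * c = 𝒢.Δ ^ p * (l' ++ [z * c]).prod := by
      rw [x1]; simp [mul_assoc]
    have e2 : r = (l' ++ [z * c]).length := by simp [hrr]
    rw [e, e2]
    refine 𝒢.ldΔ_mul (ld_refl _) (𝒢.ldΔ_list _ (fun s hs => ?_))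
    rw [List.mem_append] at hs
    rcases hs with hs | hs
    · exact (x2 s (List.mem_append_left _ hs)).1.2
    · rw [List.mem_singleton] at hs
      rw [hs, hzc]; exact 𝒢.gcdL_dvd_right _ _
  have hXcD : LeftDvd 𝒢.pos (L.prod * c) (𝒢.Δ ^ (L.length : ℤ)) := by
    obtain ⟨k, rfl⟩ : ∃ k, m = k + 1 := ⟨m - 1, by omega⟩
    have := 𝒢.ldΔ_mul (𝒢.ldΔ_pow hxD k) hxcD
    rw [← mul_assoc, ← pow_succ, X1, mul_assoc] at this
    rw [← ld_mul_left (𝒢.Δ ^ q), ← zpow_add]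
    convert this using 2
    rw [hN, hq]
    push_cast; ring
  -- step 3
  have c1 : c = 1 := by
    by_contra cne
    have := 𝒢.length_le (L ++ [c]) L.length ?_ ?_ (by simpa using hXcD)
    · simp at this
    · intro s hs
      rw [List.mem_append] at hs
      rcases hs with hs | hs
      · have := R2 s (List.mem_append_left _ hs)
        exact ⟨this.1, this.2.1⟩
      · rw [List.mem_singleton] at hs
        rw [hs]
        exact ⟨⟨cpos, ld_trans cι ιΔ⟩, cne⟩
    · have R3' := List.isChain_append.1 R3
      refine List.isChain_append.2 ⟨R3'.1, by simp, ?_⟩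
      intro Z hZ y hy
      have hZJ := R3'.2.2 Z hZ J (by simp)
      have hZs := R2 Z (List.mem_append_left _ (List.mem_of_getLast? hZ))
      simp at hy
      subst hy
      refine 𝒢.gcd_eq (ld_mul cpos) hZs.1.2 ?_
      conv_rhs => rw [← hZJ]
      exact 𝒢.dvd_gcdL _ _ _ (ld_trans (𝒢.gcdL_dvd_left _ _)
        ((ld_mul_left Z).2 (ld_trans cι hιJ))) (𝒢.gcdL_dvd_right _ _)
  rw [c1, mul_one] at hzc
  refine ⟨?_, ?_, ?_⟩
  · rw [List.prod_append (l₁ := l' ++ [z]), List.prod_singleton, ← mul_assoc (𝒢.Δ ^ p) _ ι, ← x1]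
  · intro s hs
    rw [List.mem_append] at hs
    rcases hs with hs | hs
    · exact x2 s hs
    · rw [List.mem_singleton] at hs
      rw [hs]; exact ιprop
  · refine List.isChain_append.2 ⟨x3, by simp, ?_⟩
    intro Z hZ y hy
    simp at hZ hy
    subst hZ hy
    exact hzc.symm

end aux

section opp
open MulOpposite
variable {G : Type*} [Group G] (𝒢 : GarsideGroup G)

theorem ld_op (P : Submonoid G) (a b : Gᵐᵒᵖ) :
    LeftDvd P.op a b ↔ RightDvd P a.unop b.unop := by
  simp [LeftDvd, RightDvd]

theorem rd_op (P : Submonoid G) (a b : Gᵐᵒᵖ) :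
    RightDvd P.op a b ↔ LeftDvd P a.unop b.unop := by
  simp [LeftDvd, RightDvd]

theorem simple_op (s : Gᵐᵒᵖ) :
    Simple 𝒢.pos.op (op 𝒢.Δ) s ↔ Simple 𝒢.pos 𝒢.Δ s.unop := by
  unfold Simple
  rw [ld_op, Submonoid.mem_op, 𝒢.divisors_Δ]
  simp

/-- The gcd or lcm transported to the opposite group. -/
def opFun (f : G → G → G) : Gᵐᵒᵖ → Gᵐᵒᵖ → Gᵐᵒᵖ := fun a b => op (f a.unop b.unop)

theorem lnf_op (p : ℤ) (l : List Gᵐᵒᵖ) (x : Gᵐᵒᵖ) :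
    IsLeftNF 𝒢.pos.op (op 𝒢.Δ) (opFun 𝒢.gcdR) p l x ↔
      IsRightNF 𝒢.pos 𝒢.Δ 𝒢.gcdR p (l.map unop).reverse x.unop := by
  unfold IsLeftNF IsRightNF
  refine and_congr ?_ (and_congr ?_ ?_)
  · rw [← unop_inj, unop_mul, unop_list_prod]; simp
  · simp only [simple_op, List.mem_reverse, List.mem_map]
    constructor
    · rintro h _ ⟨s, hs, rfl⟩
      have := h s hs
      refine ⟨this.1, by simpa using this.2.1, fun e => this.2.2 (by rw [← e]; simp)⟩
    · intro h s hs
      have := h _ ⟨s, hs, rfl⟩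
      refine ⟨this.1, by simpa using this.2.1, fun e => this.2.2 (by rw [e]; simp)⟩
  · show List.IsChain _ _ ↔ List.IsChain _ _
    rw [List.isChain_reverse, List.isChain_map]
    simp only [opFun, ← unop_inj]
    simp

theorem rnf_op (p : ℤ) (l : List Gᵐᵒᵖ) (x : Gᵐᵒᵖ) :
    IsRightNF 𝒢.pos.op (op 𝒢.Δ) (opFun 𝒢.gcdL) p l x ↔
      IsLeftNF 𝒢.pos 𝒢.Δ 𝒢.gcdL p (l.map unop).reverse x.unop := by
  unfold IsLeftNF IsRightNF
  refine and_congr ?_ (and_congr ?_ ?_)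
  · rw [← unop_inj, unop_mul, unop_list_prod]; simp
  · simp only [simple_op, List.mem_reverse, List.mem_map]
    constructor
    · rintro h _ ⟨s, hs, rfl⟩
      have := h s hs
      refine ⟨this.1, by simpa using this.2.1, fun e => this.2.2 (by rw [← e]; simp)⟩
    · intro h s hs
      have := h _ ⟨s, hs, rfl⟩
      refine ⟨this.1, by simpa using this.2.1, fun e => this.2.2 (by rw [e]; simp)⟩
  · show List.IsChain _ _ ↔ List.IsChain _ _
    rw [List.isChain_reverse, List.isChain_map]
    simp only [opFun, ← unop_inj]
    simp

theorem list_op_inj {l m : List Gᵐᵒᵖ} (h : (l.map unop).reverse = (m.map unop).reverse) :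
    l = m :=
  List.map_injective_iff.2 unop_injective (List.reverse_injective h)

/-- The opposite Garside structure. -/
def opG : GarsideGroup Gᵐᵒᵖ where
  pos := 𝒢.pos.op
  pos_antisymm a h h' := unop_injective (𝒢.pos_antisymm a.unop h h')
  Δ := op 𝒢.Δ
  Δ_pos := 𝒢.Δ_pos
  gcdL := opFun 𝒢.gcdR
  gcdL_dvd_left a b := (ld_op _ _ _).2 (𝒢.gcdR_dvd_left _ _)
  gcdL_dvd_right a b := (ld_op _ _ _).2 (𝒢.gcdR_dvd_right _ _)
  dvd_gcdL a b c h h' := (ld_op _ _ _).2 (𝒢.dvd_gcdR _ _ _ ((ld_op _ _ _).1 h) ((ld_op _ _ _).1 h'))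
  lcmL := opFun 𝒢.lcmR
  dvd_lcmL_left a b := (ld_op _ _ _).2 (𝒢.dvd_lcmR_left _ _)
  dvd_lcmL_right a b := (ld_op _ _ _).2 (𝒢.dvd_lcmR_right _ _)
  lcmL_dvd a b c h h' := (ld_op _ _ _).2 (𝒢.lcmR_dvd _ _ _ ((ld_op _ _ _).1 h) ((ld_op _ _ _).1 h'))
  gcdR := opFun 𝒢.gcdL
  gcdR_dvd_left a b := (rd_op _ _ _).2 (𝒢.gcdL_dvd_left _ _)
  gcdR_dvd_right a b := (rd_op _ _ _).2 (𝒢.gcdL_dvd_right _ _)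
  dvd_gcdR a b c h h' := (rd_op _ _ _).2 (𝒢.dvd_gcdL _ _ _ ((rd_op _ _ _).1 h) ((rd_op _ _ _).1 h'))
  lcmR := opFun 𝒢.lcmL
  dvd_lcmR_left a b := (rd_op _ _ _).2 (𝒢.dvd_lcmL_left _ _)
  dvd_lcmR_right a b := (rd_op _ _ _).2 (𝒢.dvd_lcmL_right _ _)
  lcmR_dvd a b c h h' := (rd_op _ _ _).2 (𝒢.lcmL_dvd _ _ _ ((rd_op _ _ _).1 h) ((rd_op _ _ _).1 h'))
  divisors_Δ s := by
    rw [ld_op, rd_op, Submonoid.mem_op]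
    exact (𝒢.divisors_Δ s.unop).symm
  simples_generate := by
    have := 𝒢.simples_generate
    have h2 := congrArg Subgroup.op this
    rw [Subgroup.op_closure, Subgroup.op_top] at h2
    rw [← h2]
    congr 1
    ext s
    exact simple_op 𝒢 s
  lnf_exists x := by
    obtain ⟨⟨p, l⟩, h⟩ := 𝒢.rnf_exists x.unop
    refine ⟨⟨p, (l.map op).reverse⟩, (lnf_op 𝒢 _ _ _).2 ?_⟩
    simpa [Function.comp_def] using h
  lnf_unique x p q l m h h' := by
    have := 𝒢.rnf_unique _ _ _ _ _ ((lnf_op 𝒢 _ _ _).1 h) ((lnf_op 𝒢 _ _ _).1 h')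
    exact ⟨this.1, list_op_inj this.2⟩
  rnf_exists x := by
    obtain ⟨⟨p, l⟩, h⟩ := 𝒢.lnf_exists x.unop
    refine ⟨⟨p, (l.map op).reverse⟩, (rnf_op 𝒢 _ _ _).2 ?_⟩
    simpa [Function.comp_def] using h
  rnf_unique x p q l m h h' := by
    have := 𝒢.lnf_unique _ _ _ _ _ ((rnf_op 𝒢 _ _ _).1 h) ((rnf_op 𝒢 _ _ _).1 h')
    exact ⟨this.1, list_op_inj this.2⟩
  lnf_rnf_agree x p q l m h h' := by
    have := 𝒢.lnf_rnf_agree _ _ _ _ _ ((rnf_op 𝒢 _ _ _).1 h') ((lnf_op 𝒢 _ _ _).1 h)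
    simp at this
    exact ⟨this.1.symm, this.2.symm⟩

theorem opG_lnf (x : G) :
    (𝒢.opG.lnf (op x)).1 = (𝒢.rnf x).1 ∧
    (𝒢.opG.lnf (op x)).2 = ((𝒢.rnf x).2.map op).reverse := by
  refine 𝒢.opG.lnf_unique (op x) _ _ _ _ (𝒢.opG.lnf_spec _) ((lnf_op 𝒢 _ _ _).2 ?_)
  simpa [Function.comp_def] using 𝒢.rnf_spec x

theorem opG_inf (x : G) : 𝒢.opG.inf (op x) = 𝒢.inf x := by
  unfold inf
  rw [(𝒢.opG_lnf x).1]
  exact (𝒢.lnf_rnf_agree _ _ _ _ _ (𝒢.lnf_spec x) (𝒢.rnf_spec x)).1.symm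

theorem opG_sup (x : G) : 𝒢.opG.sup (op x) = 𝒢.sup x := by
  unfold sup len
  rw [opG_inf, (𝒢.opG_lnf x).2]
  have := (𝒢.lnf_rnf_agree _ _ _ _ _ (𝒢.lnf_spec x) (𝒢.rnf_spec x)).2
  simp [this]

theorem opG_iota (x : G) : 𝒢.opG.iotaL (op x) = op (𝒢.iotaR x) := by
  unfold iotaL iotaR tau
  rw [(𝒢.opG_lnf x).1, (𝒢.opG_lnf x).2]
  apply unop_injective
  have : ((((𝒢.rnf x).2.map op).reverse).headD 1) = op ((𝒢.rnf x).2.getLast?.getD 1) := by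
    rw [List.headD_eq_head?_getD, List.head?_reverse, List.getLast?_map]
    cases (𝒢.rnf x).2.getLast? <;> simp
  rw [this]
  simp [opG, mul_assoc]

theorem opG_rigid (x : G) : 𝒢.opG.LeftRigid (op x) ↔ 𝒢.RightRigid x := by
  unfold LeftRigid RightRigid
  rw [opG_iota, (𝒢.opG_lnf x).1, (𝒢.opG_lnf x).2]
  refine and_congr (by simp) ?_
  refine (lnf_op 𝒢 _ _ _).trans ?_
  simp [Function.comp_def]

end opp

end GarsideGroup

/-- **Lemma 4.3.** Let `x` be an element of a Garside group `G`. If `x` is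
periodically geodesic and `x^m` is left (resp. right) rigid for some `m ≥ 1`,
then `x` is left (resp. right) rigid. -/
theorem rigid_of_periodicallyGeodesic_rigid_power {G : Type*} [Group G]
    (𝒢 : GarsideGroup G) (x : G) (hpg : 𝒢.PeriodicallyGeodesic x)
    (m : ℕ) (hm : 1 ≤ m) :
    (𝒢.LeftRigid (x ^ m) → 𝒢.LeftRigid x) ∧ (𝒢.RightRigid (x ^ m) → 𝒢.RightRigid x) := by
  refine ⟨𝒢.left_main x hpg m hm, fun h => ?_⟩
  rw [← 𝒢.opG_rigid] at h ⊢
  refine 𝒢.opG.left_main _ (fun k hk => ?_) m hm (by simpa using h)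
  rw [← MulOpposite.op_pow, 𝒢.opG_inf, 𝒢.opG_inf, 𝒢.opG_sup, 𝒢.opG_sup]
  exact hpg k hk

end Garside
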